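/- There exists a family (E_β)_{β∈ℝ} of finite-dimensional ℂ-subspaces of M, with E_β = 0 for all but finitely many β, such that: (1) E_β ⊆ V_β ∩ M and E_β ∩ V_{<β} = 0 for every β; (2) for every γ ∈ ℝ, the family of subspaces ((z^i·E_{γ−i} + V_{<γ})/V_{<γ})_{i∈ℤ} of V_γ/V_{<γ} is linearly independent and its sum equals V_γ/V_{<γ}; (3) for every γ ∈ ℝ, V_γ ∩ M is the internal direct sum of the subspaces z^j·E_β over all pairs (j,β) with j ≥ 0 and β ≤ γ − j. (Lemma 3.2.7 of 'Irregular Hodge theory'.) -/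

import Mathlib

noncomputable section

open Submodule Set

variable {N : Type*} [AddCommGroup N] [Module ℂ N]

/-- `M` is (the image of) a finite free `ℂ[z]`-module of rank `r` inside
`N = ℂ[z,z⁻¹] ⊗_{ℂ[z]} M`, where multiplication by `z` is the automorphism `z` of `N`.
This is encoded by `z`-stability of `M` together with the existence of an `r`-element
family `b` of elements of `M` such that `(z^k (b i))` for `k ∈ ℤ` is a `ℂ`-basis of `N`
and `(z^k (b i))` for `k ∈ ℕ` is a `ℂ`-basis of `M`. -/
def IsFreeLattice (z : N ≃ₗ[ℂ] N) (M : Submodule ℂ N) (r : ℕ) : Prop :=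
  (∀ x ∈ M, z x ∈ M) ∧
  ∃ b : Fin r → N,
    LinearIndependent ℂ (fun p : Fin r × ℤ => (z ^ p.2) (b p.1)) ∧
    Submodule.span ℂ (Set.range fun p : Fin r × ℤ => (z ^ p.2) (b p.1)) = ⊤ ∧
    Submodule.span ℂ (Set.range fun p : Fin r × ℕ => (z ^ (p.2 : ℤ)) (b p.1)) = M

/-- A V-lattice filtration on `N` (with jumps in `A + ℤ`, `A ⊆ [0,1)` finite):
(i) increasing; (ii) `z · V_β = V_{β+1}`; (iii) each `V_β` is stable under `z⁻¹` and
finitely generated over `ℂ[z⁻¹]`; (iv) the `ℂ[z,z⁻¹]`-span of each `V_β` is `N`;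
(v) `V_β = V_γ` if `(β,γ] ∩ (A + ℤ) = ∅`. -/
structure IsVLattice (z : N ≃ₗ[ℂ] N) (V : ℝ → Submodule ℂ N) (A : Finset ℝ) : Prop where
  mono : Monotone V
  map_z : ∀ β : ℝ, (V β).map z.toLinearMap = V (β + 1)
  zinv_stable : ∀ β : ℝ, ∀ x ∈ V β, z.symm x ∈ V β
  fg_zinv : ∀ β : ℝ, ∃ S : Finset N, (S : Set N) ⊆ (V β : Set N) ∧
    V β = Submodule.span ℂ {x : N | ∃ k : ℕ, ∃ s ∈ S, x = (z.symm ^ k) s}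
  span_laurent : ∀ β : ℝ, Submodule.span ℂ {x : N | ∃ k : ℤ, ∃ v ∈ V β, x = (z ^ k) v} = ⊤
  jumpsIn : ∀ a ∈ A, (0 : ℝ) ≤ a ∧ a < 1
  jumps : ∀ β γ : ℝ, β ≤ γ →
    (∀ a ∈ A, ∀ k : ℤ, ¬ (β < a + k ∧ a + k ≤ γ)) → V β = V γ

/-- `V_{<β} := ⋃_{γ < β} V_γ`. -/
def Vlt (V : ℝ → Submodule ℂ N) (β : ℝ) : Submodule ℂ N := ⨆ γ ∈ Set.Iio β, V γ

/-- The Harder–Narasimhan filtration of `N`: `F^HN_β(N)` is the `ℂ[z,z⁻¹]`-span of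
`V_β ∩ M`. -/
def FHN (z : N ≃ₗ[ℂ] N) (V : ℝ → Submodule ℂ N) (M : Submodule ℂ N) (β : ℝ) :
    Submodule ℂ N :=
  Submodule.span ℂ {x : N | ∃ k : ℤ, ∃ v ∈ V β ⊓ M, x = (z ^ k) v}


/-- A family of submodules is independent if its indices can be ranked in a linear order in such
a way that each member is disjoint from a submodule containing all members of lower rank. -/
theorem iSupIndep_of_rank {ι κ : Type*} [LinearOrder κ] (f : ι → κ) (F U : ι → Submodule ℂ N)
    (hle : ∀ a b, b ≠ a → f b ≤ f a → F b ≤ U a) (hdisj : ∀ a, F a ⊓ U a = ⊥) :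
    iSupIndep F := by
  classical
  rw [iSupIndep_iff_finsetSum_eq_zero_imp_eq_zero]
  intro s v
  induction s using Finset.induction_on_max_value f with
  | empty => simp
  | insert a s ha hmax ih =>
    intro hv hsum
    rw [Finset.sum_insert ha] at hsum
    have hU : ∑ i ∈ s, v i ∈ U a := Submodule.sum_mem _ fun i hi =>
      hle a i (fun h => ha (h ▸ hi)) (hmax i hi) (hv i (Finset.mem_insert_of_mem hi))
    have hva : v a = 0 := by
      have hmem : v a ∈ F a ⊓ U a := by
        refine ⟨hv a (Finset.mem_insert_self a s), ?_⟩
        rw [eq_neg_of_add_eq_zero_left hsum]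
        exact neg_mem hU
      rwa [hdisj, Submodule.mem_bot] at hmem
    rw [hva, zero_add] at hsum
    intro i hi
    rcases Finset.mem_insert.mp hi with rfl | hi
    · exact hva
    · exact ih (fun j hj => hv j (Finset.mem_insert_of_mem hj)) hsum i hi

theorem exists_relative_complement {W X : Submodule ℂ N} (h : W ≤ X) :
    ∃ E ≤ X, E ⊓ W = ⊥ ∧ W ⊔ E = X := by
  obtain ⟨C, hC⟩ := Submodule.exists_isCompl W
  refine ⟨C ⊓ X, inf_le_right, ?_, ?_⟩
  · rw [eq_bot_iff, ← hC.inf_eq_bot]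
    exact le_inf inf_le_right (inf_le_left.trans inf_le_left)
  · rw [← sup_inf_assoc_of_le C h, hC.sup_eq_top, top_inf_eq]

theorem finiteDimensional_of_inf_eq_bot {E S U : Submodule ℂ N} [FiniteDimensional ℂ S]
    (hE : E ≤ S ⊔ U) (hU : E ⊓ U = ⊥) : FiniteDimensional ℂ E := by
  have hmap : ∀ x : E, U.mkQ x ∈ S.map U.mkQ := by
    intro x
    have hx := Submodule.mem_map_of_mem (f := U.mkQ) (hE x.2)
    rwa [Submodule.map_sup, Submodule.mkQ_map_self, sup_bot_eq] at hx
  refine FiniteDimensional.of_injective ((U.mkQ.comp E.subtype).codRestrict (S.map U.mkQ) hmap) ?_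
  rw [injective_iff_map_eq_zero]
  intro x hx
  have hxU : (x : N) ∈ E ⊓ U :=
    ⟨x.2, (Submodule.Quotient.mk_eq_zero U).1 (congrArg Subtype.val hx)⟩
  rw [hU] at hxU
  simpa using hxU

theorem zpow_add_apply (z : N ≃ₗ[ℂ] N) (i j : ℤ) (x : N) :
    (z ^ (i + j)) x = (z ^ i) ((z ^ j) x) := by
  rw [zpow_add, LinearEquiv.mul_apply]

theorem symm_pow_apply (z : N ≃ₗ[ℂ] N) (n : ℕ) (x : N) :
    (z.symm ^ n) x = (z ^ (-(n : ℤ))) x := by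
  rw [zpow_neg, zpow_natCast, ← inv_pow]
  rfl

theorem IsFreeLattice.zpow_mem {z : N ≃ₗ[ℂ] N} {M : Submodule ℂ N} {r : ℕ}
    (hM : IsFreeLattice z M r) {i : ℤ} (hi : 0 ≤ i) {x : N} (hx : x ∈ M) : (z ^ i) x ∈ M := by
  lift i to ℕ using hi
  induction i with
  | zero => simpa using hx
  | succ n ih =>
    rw [Nat.cast_succ, add_comm, zpow_add_apply, zpow_one]
    exact hM.1 _ ih

/-- Every element of `N` is a combination of the `z ^ k b i` with `k` bounded above. -/
theorem exists_mem_span_zpow_le {z : N ≃ₗ[ℂ] N} {r : ℕ} {b : Fin r → N}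
    (hb : Submodule.span ℂ (Set.range fun p : Fin r × ℤ => (z ^ p.2) (b p.1)) = ⊤) (x : N) :
    ∃ K : ℤ, ∀ L ≥ K, x ∈ Submodule.span ℂ
      ((fun p : Fin r × ℤ => (z ^ p.2) (b p.1)) '' {p | p.2 ≤ L}) := by
  have hx : x ∈ Submodule.span ℂ (Set.range fun p : Fin r × ℤ => (z ^ p.2) (b p.1)) := by
    rw [hb]; trivial
  induction hx using Submodule.span_induction with
  | mem x hx =>
    obtain ⟨p, rfl⟩ := hx
    exact ⟨p.2, fun L hL => Submodule.subset_span ⟨p, hL, rfl⟩⟩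
  | zero => exact ⟨0, fun L _ => zero_mem _⟩
  | add x y _ _ hx hy =>
    obtain ⟨K, hK⟩ := hx
    obtain ⟨K', hK'⟩ := hy
    exact ⟨max K K', fun L hL => add_mem (hK L ((le_max_left _ _).trans hL))
      (hK' L ((le_max_right _ _).trans hL))⟩
  | smul c x _ hx =>
    obtain ⟨K, hK⟩ := hx
    exact ⟨K, fun L hL => Submodule.smul_mem _ c (hK L hL)⟩

namespace IsVLattice

variable {z : N ≃ₗ[ℂ] N} {V : ℝ → Submodule ℂ N} {A : Finset ℝ}

theorem apply_mem_iff (hV : IsVLattice z V A) {β : ℝ} {x : N} : z x ∈ V (β + 1) ↔ x ∈ V β := by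
  rw [← hV.map_z β]
  exact ⟨fun ⟨y, hy, h⟩ => z.injective h ▸ hy, fun h => ⟨x, h, rfl⟩⟩

theorem zpow_mem_iff (hV : IsVLattice z V A) (i : ℤ) : ∀ {β : ℝ} {x : N},
    (z ^ i) x ∈ V (β + i) ↔ x ∈ V β := by
  induction i using Int.induction_on with
  | zero => simp
  | succ n ih =>
    intro β x
    rw [add_comm (n : ℤ), zpow_add_apply, zpow_one, Int.cast_add, Int.cast_one,
      add_comm (1 : ℝ), ← add_assoc, hV.apply_mem_iff, ih]
  | pred n ih =>
    intro β x
    rw [← hV.apply_mem_iff]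
    have h : z ((z ^ (-(n : ℤ) - 1)) x) = (z ^ (-(n : ℤ))) x := by
      have := zpow_add_apply z 1 (-(n : ℤ) - 1) x
      rwa [add_sub_cancel, zpow_one, eq_comm] at this
    rw [h, Int.cast_sub, Int.cast_one, add_assoc, sub_add_cancel, ih]

theorem zpow_mem (hV : IsVLattice z V A) {i : ℤ} {β γ : ℝ} (h : β + i ≤ γ) {x : N}
    (hx : x ∈ V β) : (z ^ i) x ∈ V γ :=
  hV.mono h ((hV.zpow_mem_iff i).2 hx)

theorem le_vlt {β γ : ℝ} (h : β < γ) : V β ≤ Vlt V γ :=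
  le_iSup₂_of_le (f := fun γ' (_ : γ' ∈ Set.Iio γ) => V γ') β h le_rfl

theorem vlt_le (hV : IsVLattice z V A) (γ : ℝ) : Vlt V γ ≤ V γ :=
  iSup₂_le fun _ h => hV.mono (le_of_lt h)

theorem mem_vlt_iff (hV : IsVLattice z V A) {γ : ℝ} {x : N} :
    x ∈ Vlt V γ ↔ ∃ β < γ, x ∈ V β := by
  constructor
  · intro hx
    rw [Vlt, iSup_subtype'] at hx
    have : Nonempty (Set.Iio γ) := ⟨⟨γ - 1, by simp⟩⟩
    have hmono : Monotone fun β : Set.Iio γ => V β := fun _ _ h => hV.mono h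
    obtain ⟨β, hβ⟩ := (Submodule.mem_iSup_of_directed _ hmono.directed_le).1 hx
    exact ⟨β, β.2, hβ⟩
  · rintro ⟨β, hβ, hx⟩
    exact le_vlt hβ hx

theorem zpow_mem_vlt (hV : IsVLattice z V A) {i : ℤ} {β γ : ℝ} (h : β + i ≤ γ) {x : N}
    (hx : x ∈ Vlt V β) : (z ^ i) x ∈ Vlt V γ := by
  obtain ⟨δ, hδ, hx⟩ := hV.mem_vlt_iff.1 hx
  exact hV.mem_vlt_iff.2 ⟨δ + i, by linarith, (hV.zpow_mem_iff i).2 hx⟩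

theorem exists_gt_eq (hV : IsVLattice z V A) (γ : ℝ) : ∃ δ > γ, V γ = V δ := by
  have h : ∀ᶠ δ in nhdsWithin γ (Set.Ioi γ), ∀ a ∈ A, δ < a + ⌊γ - a⌋ + 1 := by
    rw [Filter.eventually_all_finset]
    intro a _
    refine Filter.Eventually.filter_mono nhdsWithin_le_nhds (Iio_mem_nhds ?_)
    linarith [Int.lt_floor_add_one (γ - a)]
  obtain ⟨δ, hδ, hγ⟩ := (h.and self_mem_nhdsWithin).exists
  refine ⟨δ, hγ, hV.jumps γ δ (le_of_lt hγ) ?_⟩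
  rintro a ha k ⟨h1, h2⟩
  have h3 : ⌊γ - a⌋ < k := Int.floor_lt.2 (by linarith)
  have h4 : ((⌊γ - a⌋ + 1 : ℤ) : ℝ) ≤ k := by exact_mod_cast h3
  push_cast at h4
  linarith [hδ a ha]

theorem le_vlt_of_forall_ne (hV : IsVLattice z V A) {γ : ℝ} (h : ∀ a ∈ A, ∀ k : ℤ, a + k ≠ γ) :
    V γ ≤ Vlt V γ := by
  have h' : ∀ᶠ δ in nhdsWithin γ (Set.Iio γ), ∀ a ∈ A, a + ⌊γ - a⌋ < δ := by
    rw [Filter.eventually_all_finset]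
    intro a ha
    refine Filter.Eventually.filter_mono nhdsWithin_le_nhds (Ioi_mem_nhds ?_)
    exact lt_of_le_of_ne (by linarith [Int.floor_le (γ - a)]) (h a ha _)
  obtain ⟨δ, hδ, hγ⟩ := (h'.and self_mem_nhdsWithin).exists
  have heq : V δ = V γ := by
    refine hV.jumps δ γ (le_of_lt hγ) ?_
    rintro a ha k ⟨h1, h2⟩
    have h3 : k ≤ ⌊γ - a⌋ := Int.le_floor.2 (by linarith)
    have h4 : (k : ℝ) ≤ ⌊γ - a⌋ := by exact_mod_cast h3
    linarith [hδ a ha]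
  exact heq ▸ le_vlt hγ

theorem le_span_sup_vlt (hV : IsVLattice z V A) (γ : ℝ) :
    ∃ S : Finset N, V γ ≤ Submodule.span ℂ (S : Set N) ⊔ Vlt V γ := by
  obtain ⟨S, hS, hspan⟩ := hV.fg_zinv γ
  refine ⟨S, ?_⟩
  conv_lhs => rw [hspan]
  rw [Submodule.span_le]
  rintro _ ⟨k, s, hs, rfl⟩
  rcases Nat.eq_zero_or_pos k with rfl | hk
  · exact Submodule.mem_sup_left (Submodule.subset_span (by simpa using hs))
  · refine Submodule.mem_sup_right (hV.mem_vlt_iff.2 ⟨γ + (-(k : ℤ) : ℤ), ?_, ?_⟩)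
    · have : (0 : ℝ) < k := by exact_mod_cast hk
      push_cast
      linarith
    · rw [symm_pow_apply, hV.zpow_mem_iff]
      exact hS hs

theorem exists_mem (hV : IsVLattice z V A) (x : N) : ∃ γ, x ∈ V γ := by
  have hx : x ∈ Submodule.span ℂ {x : N | ∃ k : ℤ, ∃ v ∈ V 0, x = (z ^ k) v} := by
    rw [hV.span_laurent]; trivial
  induction hx using Submodule.span_induction with
  | mem x hx =>
    obtain ⟨k, v, hv, rfl⟩ := hx
    exact ⟨0 + k, (hV.zpow_mem_iff k).2 hv⟩
  | zero => exact ⟨0, zero_mem _⟩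
  | add x y _ _ hx hy =>
    obtain ⟨β, hβ⟩ := hx
    obtain ⟨γ, hγ⟩ := hy
    exact ⟨max β γ, add_mem (hV.mono (le_max_left _ _) hβ) (hV.mono (le_max_right _ _) hγ)⟩
  | smul c x _ hx =>
    obtain ⟨β, hβ⟩ := hx
    exact ⟨β, Submodule.smul_mem _ c hβ⟩

theorem exists_forall_mem_of_finite (hV : IsVLattice z V A) {r : ℕ} (b : Fin r → N) :
    ∃ γ, ∀ i, b i ∈ V γ := by
  choose g hg using fun i => hV.exists_mem (b i)
  obtain ⟨γ, hγ⟩ := (Set.finite_range g).bddAbove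
  exact ⟨γ, fun i => hV.mono (hγ ⟨i, rfl⟩) (hg i)⟩

variable {M : Submodule ℂ N} {r : ℕ}

theorem exists_sup_eq_top (hV : IsVLattice z V A) (hM : IsFreeLattice z M r) :
    ∃ K : ℝ, M ⊔ V K = ⊤ := by
  obtain ⟨-, b, -, htop, hspan⟩ := hM
  obtain ⟨K, hK⟩ := hV.exists_forall_mem_of_finite b
  refine ⟨K, ?_⟩
  rw [eq_top_iff, ← htop, Submodule.span_le]
  rintro _ ⟨⟨i, k⟩, rfl⟩
  rcases le_total 0 k with hk | hk
  · lift k to ℕ using hk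
    refine Submodule.mem_sup_left ?_
    rw [← hspan]
    exact Submodule.subset_span ⟨(i, k), rfl⟩
  · refine Submodule.mem_sup_right (hV.zpow_mem ?_ (hK i))
    have : (k : ℝ) ≤ 0 := by exact_mod_cast hk
    linarith

theorem sup_map_zpow_eq_top (hV : IsVLattice z V A) {K : ℝ} (hK : M ⊔ V K = ⊤) (n : ℤ) (x : N) :
    ∃ m ∈ M, ∃ v ∈ V (K + n), (z ^ n) m + v = x := by
  have hx : (z ^ (-n)) x ∈ M ⊔ V K := by rw [hK]; trivial
  obtain ⟨m, hm, v, hv, h⟩ := Submodule.mem_sup.1 hx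
  refine ⟨m, hm, (z ^ n) v, (hV.zpow_mem_iff n).2 hv, ?_⟩
  rw [← map_add, h, ← zpow_add_apply]
  simp

theorem exists_inf_eq_bot (hV : IsVLattice z V A) (hM : IsFreeLattice z M r) :
    ∃ L : ℝ, V L ⊓ M = ⊥ := by
  obtain ⟨-, b, hli, htop, hspan⟩ := hM
  obtain ⟨S, -, hS⟩ := hV.fg_zinv 0
  choose g hg using fun x => exists_mem_span_zpow_le htop x
  obtain ⟨K, hK⟩ := (S.finite_toSet.image g).bddAbove
  refine ⟨((-K - 1 : ℤ) : ℝ), ?_⟩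
  rw [eq_bot_iff, ← (hli.disjoint_span_image (s := {p | p.2 ≤ -1}) (t := {p | 0 ≤ p.2})
    (Set.disjoint_left.2 fun p hp hp' => by
      simp only [Set.mem_ofPred_eq] at hp hp'
      omega)).eq_bot]
  refine inf_le_inf ?_ ?_
  · intro x hx
    have hx0 : (z ^ (K + 1)) x ∈ V 0 :=
      hV.zpow_mem (by push_cast; linarith) hx
    have key : V 0 ≤ (Submodule.span ℂ
        ((fun p : Fin r × ℤ => (z ^ p.2) (b p.1)) '' {p | p.2 ≤ -1})).comap
          (z ^ (-(K + 1))).toLinearMap := by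
      rw [hS, Submodule.span_le]
      rintro _ ⟨k, s, hs, rfl⟩
      have hsK := hg s K (hK ⟨s, hs, rfl⟩)
      rw [SetLike.mem_coe, Submodule.mem_comap, LinearEquiv.coe_coe, symm_pow_apply,
        ← zpow_add_apply]
      have := Submodule.mem_map_of_mem (f := (z ^ (-(K + 1) + -(k : ℤ))).toLinearMap) hsK
      rw [Submodule.map_span] at this
      refine Submodule.span_mono ?_ this
      rintro _ ⟨_, ⟨p, hp, rfl⟩, rfl⟩
      refine ⟨(p.1, -(K + 1) + -(k : ℤ) + p.2), ?_, ?_⟩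
      · simp only [Set.mem_ofPred_eq] at hp ⊢
        omega
      · exact zpow_add_apply z _ _ _
    have := key hx0
    rw [Submodule.mem_comap, LinearEquiv.coe_coe, ← zpow_add_apply, neg_add_cancel] at this
    simpa using this
  · rw [← hspan, Submodule.span_le]
    rintro _ ⟨p, rfl⟩
    exact Submodule.subset_span ⟨(p.1, (p.2 : ℤ)), by simp, rfl⟩

end IsVLattice

/-- `E` picks, for each `β`, a complement of `V_β ∩ zM + V_{<β} ∩ M` in `V_β ∩ M`. -/
def IsHNComplement (z : N ≃ₗ[ℂ] N) (V : ℝ → Submodule ℂ N) (M : Submodule ℂ N)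
    (E : ℝ → Submodule ℂ N) : Prop :=
  ∀ β, E β ≤ V β ⊓ M ∧ E β ⊓ ((V β ⊓ M.map z.toLinearMap) ⊔ (Vlt V β ⊓ M)) = ⊥ ∧
    ((V β ⊓ M.map z.toLinearMap) ⊔ (Vlt V β ⊓ M)) ⊔ E β = V β ⊓ M

section

variable {z : N ≃ₗ[ℂ] N} {V : ℝ → Submodule ℂ N} {A : Finset ℝ} {M : Submodule ℂ N} {r : ℕ}
  {E : ℝ → Submodule ℂ N}

theorem exists_isHNComplement (hM : IsFreeLattice z M r) (hV : IsVLattice z V A) :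
    ∃ E, IsHNComplement z V M E := by
  have h : ∀ β, (V β ⊓ M.map z.toLinearMap) ⊔ (Vlt V β ⊓ M) ≤ V β ⊓ M := by
    intro β
    refine sup_le (inf_le_inf_left _ ?_) (inf_le_inf_right _ (hV.vlt_le β))
    rw [Submodule.map_le_iff_le_comap]
    exact hM.1
  choose E hE using fun β => exists_relative_complement (h β)
  exact ⟨E, hE⟩

namespace IsHNComplement

theorem inf_sup_vlt_eq_bot (hE : IsHNComplement z V M E) (hM : IsFreeLattice z M r) (β : ℝ) :
    E β ⊓ ((V β ⊓ M.map z.toLinearMap) ⊔ Vlt V β) = ⊥ := by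
  rw [eq_bot_iff, ← (hE β).2.1]
  rintro x ⟨hx, hx'⟩
  refine ⟨hx, ?_⟩
  obtain ⟨y, hy, v, hv, rfl⟩ := Submodule.mem_sup.1 hx'
  refine add_mem (Submodule.mem_sup_left hy) (Submodule.mem_sup_right ⟨hv, ?_⟩)
  obtain ⟨m, hm, rfl⟩ := hy.2
  have h := sub_mem ((hE β).1 hx).2 (hM.1 m hm)
  simpa using h

theorem inf_vlt_eq_bot (hE : IsHNComplement z V M E) (hM : IsFreeLattice z M r) (β : ℝ) :
    E β ⊓ Vlt V β = ⊥ := by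
  rw [eq_bot_iff, ← hE.inf_sup_vlt_eq_bot hM β]
  exact inf_le_inf_left _ le_sup_right

theorem finiteDimensional (hE : IsHNComplement z V M E) (hM : IsFreeLattice z M r)
    (hV : IsVLattice z V A) (β : ℝ) : FiniteDimensional ℂ (E β) := by
  obtain ⟨S, hS⟩ := hV.le_span_sup_vlt β
  exact finiteDimensional_of_inf_eq_bot (((hE β).1.trans inf_le_left).trans hS)
    (hE.inf_vlt_eq_bot hM β)

theorem eq_bot_of_large (hE : IsHNComplement z V M E) (hM : IsFreeLattice z M r)
    (hV : IsVLattice z V A) {K β : ℝ} (hK : M ⊔ V K = ⊤) (hβ : K + 1 < β) : E β = ⊥ := by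
  rw [eq_bot_iff, ← hE.inf_sup_vlt_eq_bot hM β]
  refine le_inf le_rfl fun x hx => ?_
  obtain ⟨m, hm, v, hv, rfl⟩ := hV.sup_map_zpow_eq_top hK 1 x
  have hvlt : v ∈ Vlt V β := hV.mem_vlt_iff.2 ⟨_, by simpa using hβ, hv⟩
  refine add_mem (Submodule.mem_sup_left ⟨?_, m, hm, by simp⟩) (Submodule.mem_sup_right hvlt)
  have h := sub_mem ((hE β).1 hx).1 (hV.vlt_le β hvlt)
  simpa using h

theorem finite_ne_bot (hE : IsHNComplement z V M E) (hM : IsFreeLattice z M r)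
    (hV : IsVLattice z V A) : {β : ℝ | E β ≠ ⊥}.Finite := by
  obtain ⟨K, hK⟩ := hV.exists_sup_eq_top hM
  obtain ⟨L, hL⟩ := hV.exists_inf_eq_bot hM
  refine ((A ×ˢ Finset.Icc ⌊L - 1⌋ ⌈K + 1⌉).finite_toSet.image
    fun p : ℝ × ℤ => p.1 + p.2).subset ?_
  intro β hβ
  have hβK : β ≤ K + 1 := by
    by_contra! h
    exact hβ (hE.eq_bot_of_large hM hV hK h)
  have hLβ : L ≤ β := by
    by_contra! h
    refine hβ (eq_bot_iff.2 ?_)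
    rw [← hL]
    exact (hE β).1.trans (inf_le_inf_right _ (hV.mono h.le))
  by_contra! hjump
  refine hβ (eq_bot_iff.2 ?_)
  rw [← hE.inf_vlt_eq_bot hM β]
  refine le_inf le_rfl (((hE β).1.trans inf_le_left).trans (hV.le_vlt_of_forall_ne ?_))
  rintro a ha k rfl
  refine hjump ⟨(a, k), ?_, rfl⟩
  obtain ⟨ha0, ha1⟩ := hV.jumpsIn a ha
  rw [Finset.mem_coe, Finset.mem_product, Finset.mem_Icc]
  refine ⟨ha, ?_, ?_⟩
  · have h : ((⌊L - 1⌋ : ℤ) : ℝ) ≤ k := (Int.floor_le _).trans (by linarith)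
    exact_mod_cast h
  · have h : (k : ℝ) ≤ (⌈K + 1⌉ : ℤ) := le_trans (by linarith) (Int.le_ceil _)
    exact_mod_cast h

theorem le_iSup (hE : IsHNComplement z V M E) (hM : IsFreeLattice z M r)
    (hV : IsVLattice z V A) (γ : ℝ) :
    V γ ⊓ M ≤ ⨆ (j : ℕ) (β : ℝ) (_ : β ≤ γ - j), (E β).map ((z ^ (j : ℤ)).toLinearMap) := by
  set T : ℝ → Submodule ℂ N := fun γ =>
    ⨆ (j : ℕ) (β : ℝ) (_ : β ≤ γ - j), (E β).map ((z ^ (j : ℤ)).toLinearMap) with hT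
  have hle : ∀ {γ β : ℝ} {j : ℕ}, β ≤ γ - j → (E β).map ((z ^ (j : ℤ)).toLinearMap) ≤ T γ := by
    intro γ β j h
    exact le_iSup_of_le j (le_iSup₂_of_le β h le_rfl)
  have hmono : Monotone T := fun γ γ' h => iSup_le fun j => iSup₂_le fun β hβ =>
    hle (hβ.trans (by linarith))
  have hshift : ∀ γ, (T (γ - 1)).map z.toLinearMap ≤ T γ := by
    intro γ
    simp only [hT, Submodule.map_iSup]
    refine iSup_le fun j => iSup₂_le fun β hβ => ?_
    rintro _ ⟨_, ⟨e, he, rfl⟩, rfl⟩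
    refine hle (γ := γ) (β := β) (j := j + 1) (by push_cast; linarith) ⟨e, he, ?_⟩
    have := zpow_add_apply z 1 j e
    rw [zpow_one, add_comm] at this
    simpa using this
  obtain ⟨L, hL⟩ := hV.exists_inf_eq_bot hM
  change V γ ⊓ M ≤ T γ
  by_contra hγ
  set B : Set ℝ := {γ | ¬ V γ ⊓ M ≤ T γ} with hB
  have hbdd : BddBelow B := by
    refine ⟨L, fun δ hδ => ?_⟩
    by_contra! h
    exact hδ (((inf_le_inf_right M (hV.mono h.le)).trans hL.le).trans bot_le)
  have hne : B.Nonempty := ⟨γ, hγ⟩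
  obtain ⟨δ, hδ, hVδ⟩ := hV.exists_gt_eq (sInf B)
  obtain ⟨γ', hγ', hlt⟩ := exists_lt_of_csInf_lt hne hδ
  have hg : sInf B ≤ γ' := csInf_le hbdd hγ'
  have hbelow : ∀ β < sInf B, V β ⊓ M ≤ T β := fun β hβ => by
    by_contra h
    exact absurd (csInf_le hbdd h) (not_le.2 hβ)
  refine hγ' (le_trans (inf_le_inf_right M ((hV.mono hlt.le).trans hVδ.ge)) (le_trans ?_ (hmono hg)))
  rw [← (hE (sInf B)).2.2]
  refine sup_le (sup_le ?_ ?_) ?_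
  · rintro _ ⟨hx, m, hm, rfl⟩
    refine hshift _ (Submodule.mem_map_of_mem (hbelow _ (by linarith) ⟨?_, hm⟩))
    exact hV.apply_mem_iff.1 (by rwa [sub_add_cancel])
  · rintro x ⟨hx, hxM⟩
    obtain ⟨β, hβ, hx⟩ := hV.mem_vlt_iff.1 hx
    exact hmono hβ.le (hbelow β hβ ⟨hx, hxM⟩)
  · intro e he
    exact hle (γ := sInf B) (β := sInf B) (j := 0) (by simp) ⟨e, he, by simp⟩

theorem iSup_eq (hE : IsHNComplement z V M E) (hM : IsFreeLattice z M r)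
    (hV : IsVLattice z V A) (γ : ℝ) :
    (⨆ (j : ℕ) (β : ℝ) (_ : β ≤ γ - j), (E β).map ((z ^ (j : ℤ)).toLinearMap)) = V γ ⊓ M := by
  refine le_antisymm (iSup_le fun j => iSup₂_le fun β hβ => ?_) (hE.le_iSup hM hV γ)
  rintro _ ⟨e, he, rfl⟩
  obtain ⟨heV, heM⟩ := (hE β).1 he
  exact ⟨hV.zpow_mem (by push_cast; linarith) heV, hM.zpow_mem (by positivity) heM⟩

theorem iSup_sup_vlt_eq (hE : IsHNComplement z V M E) (hM : IsFreeLattice z M r)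
    (hV : IsVLattice z V A) (γ : ℝ) :
    (⨆ i : ℤ, (E (γ - i)).map ((z ^ i).toLinearMap)) ⊔ Vlt V γ = V γ := by
  refine le_antisymm (sup_le (iSup_le fun i => ?_) (hV.vlt_le γ)) fun x hx => ?_
  · rintro _ ⟨e, he, rfl⟩
    exact hV.zpow_mem (by linarith) ((hE _).1 he).1
  · obtain ⟨K, hK⟩ := hV.exists_sup_eq_top hM
    set n : ℤ := ⌊γ - K⌋ - 1
    have hn : (n : ℝ) = ⌊γ - K⌋ - 1 := by simp [n]
    obtain ⟨m, hm, v, hv, rfl⟩ := hV.sup_map_zpow_eq_top hK n x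
    have hvlt : v ∈ Vlt V γ :=
      hV.mem_vlt_iff.2 ⟨_, by linarith [Int.floor_le (γ - K)], hv⟩
    refine add_mem ?_ (Submodule.mem_sup_right hvlt)
    have hmV : (z ^ n) m ∈ V ((γ - n) + n) := by
      rw [sub_add_cancel]
      simpa using sub_mem hx (hV.vlt_le γ hvlt)
    rw [hV.zpow_mem_iff] at hmV
    have hmT := hE.le_iSup hM hV (γ - n) ⟨hmV, hm⟩
    have key : (⨆ (j : ℕ) (β : ℝ) (_ : β ≤ γ - n - j), (E β).map ((z ^ (j : ℤ)).toLinearMap)) ≤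
        ((⨆ i : ℤ, (E (γ - i)).map ((z ^ i).toLinearMap)) ⊔ Vlt V γ).comap
          (z ^ n).toLinearMap := by
      refine iSup_le fun j => iSup₂_le fun β hβ => ?_
      rintro _ ⟨e, he, rfl⟩
      rw [Submodule.mem_comap, LinearEquiv.coe_coe, LinearEquiv.coe_coe, ← zpow_add_apply]
      rcases hβ.eq_or_lt with rfl | hβ
      · refine Submodule.mem_sup_left (Submodule.mem_iSup_of_mem (n + j) ⟨e, ?_, rfl⟩)
        push_cast
        rwa [← sub_sub]
      · refine Submodule.mem_sup_right (hV.mem_vlt_iff.2 ⟨β + (n + j : ℤ), ?_, ?_⟩)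
        · push_cast
          linarith
        · exact (hV.zpow_mem_iff _).2 ((hE β).1 he).1
    exact key hmT

theorem map_le_map (hE : IsHNComplement z V M E) (hM : IsFreeLattice z M r)
    (hV : IsVLattice z V A) {i j : ℤ} {β γ : ℝ} (h : β + i < γ + j ∨ β + i = γ + j ∧ j < i) :
    (E β).map ((z ^ i).toLinearMap) ≤
      ((V γ ⊓ M.map z.toLinearMap) ⊔ Vlt V γ).map ((z ^ j).toLinearMap) := by
  rintro _ ⟨e, he, rfl⟩
  obtain ⟨heV, heM⟩ := (hE β).1 he
  refine ⟨(z ^ (i - j)) e, ?_, ?_⟩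
  · rcases h with h | ⟨h, hij⟩
    · exact Submodule.mem_sup_right (hV.mem_vlt_iff.2
        ⟨β + (i - j : ℤ), by push_cast; linarith, (hV.zpow_mem_iff _).2 heV⟩)
    · refine Submodule.mem_sup_left ⟨hV.zpow_mem (by push_cast; linarith) heV,
        (z ^ (i - j - 1)) e, hM.zpow_mem (by omega) heM, ?_⟩
      have := zpow_add_apply z 1 (i - j - 1) e
      rw [zpow_one] at this
      rw [LinearEquiv.coe_coe, ← this]
      congr 2
      ring
  · rw [LinearEquiv.coe_coe, LinearEquiv.coe_coe, ← zpow_add_apply]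
    congr 2
    ring

theorem map_inf_map_eq_bot (hE : IsHNComplement z V M E) (hM : IsFreeLattice z M r)
    (i : ℤ) (β : ℝ) : (E β).map ((z ^ i).toLinearMap) ⊓
      ((V β ⊓ M.map z.toLinearMap) ⊔ Vlt V β).map ((z ^ i).toLinearMap) = ⊥ := by
  rw [← Submodule.map_inf _ (z ^ i).injective, hE.inf_sup_vlt_eq_bot hM, Submodule.map_bot]

theorem iSupIndep_map (hE : IsHNComplement z V M E) (hM : IsFreeLattice z M r)
    (hV : IsVLattice z V A) :
    iSupIndep fun p : ℕ × ℝ => (E p.2).map ((z ^ (p.1 : ℤ)).toLinearMap) := by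
  refine iSupIndep_of_rank (fun p : ℕ × ℝ => toLex (p.2 + p.1, -(p.1 : ℤ))) _
    (fun p => ((V p.2 ⊓ M.map z.toLinearMap) ⊔ Vlt V p.2).map ((z ^ (p.1 : ℤ)).toLinearMap))
    ?_ fun p => hE.map_inf_map_eq_bot hM _ _
  rintro ⟨j, γ⟩ ⟨i, β⟩ hne hle
  rw [Prod.Lex.toLex_le_toLex] at hle
  refine hE.map_le_map hM hV ?_
  rcases hle with h | ⟨h, hij⟩
  · exact Or.inl (by simpa using h)
  · refine Or.inr ⟨by simpa using h, lt_of_le_of_ne (by simpa using hij) ?_⟩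
    intro hji
    have hji' : j = i := by exact_mod_cast hji
    subst hji'
    exact hne (Prod.ext rfl (by simpa using h))

theorem disjoint_iSup_sup_vlt (hE : IsHNComplement z V M E) (hM : IsFreeLattice z M r)
    (hV : IsVLattice z V A) (γ : ℝ) (i : ℤ) :
    Disjoint ((E (γ - i)).map ((z ^ i).toLinearMap))
      ((⨆ (j : ℤ) (_ : j ≠ i), (E (γ - j)).map ((z ^ j).toLinearMap)) ⊔ Vlt V γ) := by
  let F : Option ℤ → Submodule ℂ N :=
    fun o => o.elim (Vlt V γ) fun j => (E (γ - j)).map ((z ^ j).toLinearMap)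
  have hF : iSupIndep F := by
    refine iSupIndep_of_rank (fun o => o.elim (⊥ : WithBot ℤ) fun j => ((-j : ℤ) : WithBot ℤ)) F
      (fun o => o.elim ⊥ fun j =>
        ((V (γ - j) ⊓ M.map z.toLinearMap) ⊔ Vlt V (γ - j)).map ((z ^ j).toLinearMap)) ?_ ?_
    · rintro (_ | j) (_ | k) hne hle
      · exact absurd rfl hne
      · simp at hle
      · intro x hx
        refine ⟨(z ^ (-j)) x, Submodule.mem_sup_right
          (hV.zpow_mem_vlt (by push_cast; linarith) hx), ?_⟩
        rw [LinearEquiv.coe_coe, ← zpow_add_apply]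
        simp
      · refine hE.map_le_map hM hV (Or.inr ⟨by ring, lt_of_le_of_ne ?_ ?_⟩)
        · simpa [WithBot.coe_le_coe] using hle
        · rintro rfl
          exact hne rfl
    · rintro (_ | j)
      · exact inf_bot_eq _
      · exact hE.map_inf_map_eq_bot hM _ _
  refine (hF (some i)).mono_right (sup_le (iSup₂_le fun j hj => ?_) ?_)
  · exact le_iSup₂_of_le (f := fun o (_ : o ≠ some i) => F o) (some j) (by simpa using hj) le_rfl
  · exact le_iSup₂_of_le (f := fun o (_ : o ≠ some i) => F o) none (by simp) le_rfl

end IsHNComplement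

end

/-- Lemma 3.2.7: there exists a family `(E_β)` of finite-dimensional subspaces of `M`,
zero for all but finitely many `β`, such that:
(1) `E_β ⊆ V_β ∩ M` and `E_β ∩ V_{<β} = 0`;
(2) for every `γ`, the family of subspaces `(z^i·E_{γ−i} + V_{<γ})/V_{<γ}` of
`V_γ/V_{<γ}` (`i ∈ ℤ`) is linearly independent with sum `V_γ/V_{<γ}`;
(3) for every `γ`, `V_γ ∩ M = ⊕_{j ≥ 0, β ≤ γ − j} z^j·E_β` (internal direct sum). -/
theorem statement2 (z : N ≃ₗ[ℂ] N) (M : Submodule ℂ N) (r : ℕ)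
    (V : ℝ → Submodule ℂ N) (A : Finset ℝ)
    (hM : IsFreeLattice z M r) (hV : IsVLattice z V A) :
    ∃ E : ℝ → Submodule ℂ N,
      (∀ β : ℝ, FiniteDimensional ℂ (E β)) ∧
      {β : ℝ | E β ≠ ⊥}.Finite ∧
      (∀ β : ℝ, E β ≤ V β ⊓ M ∧ E β ⊓ Vlt V β = ⊥) ∧
      (∀ γ : ℝ,
        ((⨆ i : ℤ, (E (γ - i)).map ((z ^ i).toLinearMap)) ⊔ Vlt V γ = V γ) ∧
        (∀ i : ℤ,
          ((E (γ - i)).map ((z ^ i).toLinearMap) ⊔ Vlt V γ) ⊓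
            ((⨆ (j : ℤ) (_ : j ≠ i), (E (γ - j)).map ((z ^ j).toLinearMap)) ⊔ Vlt V γ) ≤
            Vlt V γ)) ∧
      (∀ γ : ℝ,
        ((⨆ (j : ℕ) (β : ℝ) (_ : β ≤ γ - j), (E β).map ((z ^ (j : ℤ)).toLinearMap))
            = V γ ⊓ M) ∧
        (∀ (j : ℕ) (β : ℝ), β ≤ γ - j →
          ((E β).map ((z ^ (j : ℤ)).toLinearMap)) ⊓
            (⨆ (j' : ℕ) (β' : ℝ) (_ : β' ≤ γ - j') (_ : (j', β') ≠ (j, β)),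
              (E β').map ((z ^ (j' : ℤ)).toLinearMap)) = ⊥)) := by
  obtain ⟨E, hE⟩ := exists_isHNComplement hM hV
  refine ⟨E, hE.finiteDimensional hM hV, hE.finite_ne_bot hM hV,
    fun β => ⟨(hE β).1, hE.inf_vlt_eq_bot hM β⟩,
    fun γ => ⟨hE.iSup_sup_vlt_eq hM hV γ, fun i => ?_⟩,
    fun γ => ⟨hE.iSup_eq hM hV γ, fun j β _ => ?_⟩⟩
  · rw [sup_comm, sup_inf_assoc_of_le _ le_sup_right,
      (hE.disjoint_iSup_sup_vlt hM hV γ i).eq_bot, sup_bot_eq]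
  · refine ((hE.iSupIndep_map hM hV (j, β)).mono_right ?_).eq_bot
    refine iSup_le fun j' => iSup_le fun β' => iSup₂_le fun _ hne => ?_
    exact le_iSup₂_of_le (f := fun (p : ℕ × ℝ) (_ : p ≠ (j, β)) =>
      (E p.2).map ((z ^ (p.1 : ℤ)).toLinearMap)) (j', β') hne le_rfl
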